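/- arXiv:1310.5071 — 3 statements merged into one kernel-verified Lean document; each statement's English description precedes it below -/
import Mathlib

section
/- The assignments x ↦ (y⁻¹ − q⁻¹y)x⁻¹ and y ↦ −y⁻¹ extend to a k-algebra automorphism φ of D = k_q(x,y), and φ has order 2, i.e. φ∘φ is the identity on D. -/
/-- `D`, together with the distinguished nonzero elements `x`, `y` satisfying
`x * y = q • (y * x)`, is the `q`-division ring `k_q(x,y)`: the Ore division ring of fractions
of the quantum plane `k_q[x,y]`.  The quantum plane sits inside `D` as the `k`-subalgebra
generated by `x` and `y`; linear independence of the monomials `yⁱxʲ` says that this subalgebra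
really is the quantum plane, and `exists_frac` says that `D` is its ring of (left) fractions. -/
structure IsQDivisionRing (k : Type*) [Field k] (D : Type*) [DivisionRing D] [Algebra k D]
    (q : k) (x y : D) : Prop where
  x_ne_zero : x ≠ 0
  y_ne_zero : y ≠ 0
  rel : x * y = algebraMap k D q * (y * x)
  monomials_linearIndependent :
    LinearIndependent k fun p : ℕ × ℕ => y ^ p.1 * x ^ p.2
  exists_frac : ∀ d : D, ∃ s t : D, s ∈ Algebra.adjoin k ({x, y} : Set D) ∧
    t ∈ Algebra.adjoin k ({x, y} : Set D) ∧ t ≠ 0 ∧ d = t⁻¹ * s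

open Polynomial nonZeroDivisors

/-- If a ring `R` embeds in a division ring `D` consisting of left fractions of elements of `R`,
then every embedding of `R` into a division ring extends to `D`. -/
theorem exists_algHom_extending_of_left_fractions {k R D E : Type*} [Field k] [Ring R] [Algebra k R]
    [DivisionRing D] [Algebra k D] [DivisionRing E] [Algebra k E] (f : R →ₐ[k] D) (g : R →ₐ[k] E)
    (hf : Function.Injective f) (hg : Function.Injective g)
    (hfrac : ∀ d : D, ∃ s t : R, t ≠ 0 ∧ d = (f t)⁻¹ * f s) :
    ∃ φ : D →ₐ[k] E, ∀ r, φ (f r) = g r := by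
  have : IsDomain R := hf.isDomain f.toRingHom
  have hne : ∀ s : R⁰, f s ≠ 0 := fun s =>
    (map_ne_zero_iff f hf).2 (nonZeroDivisors.ne_zero s.2)
  have hne' : ∀ s : R⁰, g s ≠ 0 := fun s =>
    (map_ne_zero_iff g hg).2 (nonZeroDivisors.ne_zero s.2)
  obtain ⟨hOre⟩ : Nonempty (OreLocalization.OreSet R⁰) := by
    rw [OreLocalization.nonempty_oreSet_iff_of_noZeroDivisors]
    intro r s
    obtain ⟨a, b, hb, hab⟩ := hfrac (f r * (f s)⁻¹)
    refine ⟨a, ⟨b, mem_nonZeroDivisors_of_ne_zero hb⟩, hf ?_⟩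
    have hb' : f b ≠ 0 := (map_ne_zero_iff f hf).2 hb
    rw [map_mul, map_mul, ← mul_inv_cancel_left₀ hb' (f a), ← hab, mul_assoc, mul_assoc,
      inv_mul_cancel₀ (hne s), mul_one]
  let uf : R⁰ →* Dˣ :=
    { toFun s := Units.mk0 (f s) (hne s)
      map_one' := by ext; simp
      map_mul' a b := by ext; simp }
  let ug : R⁰ →* Eˣ :=
    { toFun s := Units.mk0 (g s) (hne' s)
      map_one' := by ext; simp
      map_mul' a b := by ext; simp }
  let F := OreLocalization.universalHom f.toRingHom uf fun _ => rfl
  let G := OreLocalization.universalHom g.toRingHom ug fun _ => rfl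
  have hF : ∀ r, F (OreLocalization.numeratorHom r) = f r := fun r =>
    OreLocalization.universalHom_commutes _ _ _
  have hG : ∀ r, G (OreLocalization.numeratorHom r) = g r := fun r =>
    OreLocalization.universalHom_commutes _ _ _
  have hbij : Function.Bijective F := by
    refine ⟨F.injective, fun d => ?_⟩
    obtain ⟨s, t, ht, rfl⟩ := hfrac d
    refine ⟨(OreLocalization.numeratorHom t)⁻¹ * OreLocalization.numeratorHom s, ?_⟩
    rw [map_mul, map_inv₀, hF, hF]
  let e := RingEquiv.ofBijective F hbij
  have key : ∀ r, G (e.symm (f r)) = g r := fun r => by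
    rw [← hF, ← hG]
    exact congrArg G (e.symm_apply_apply (OreLocalization.numeratorHom r))
  refine ⟨{ G.comp e.symm.toRingHom with commutes' := fun c => ?_ }, key⟩
  have := key (algebraMap k R c)
  rwa [f.commutes, g.commutes] at this

namespace QuantumPlane

/-- The defining relation `xy = q yx` of the quantum plane, with `x`, `y` the generators `0`, `1`
of the free algebra. -/
inductive Rel {k : Type*} [Field k] (q : k) :
    FreeAlgebra k (Fin 2) → FreeAlgebra k (Fin 2) → Prop
  | comm : Rel q (FreeAlgebra.ι k 0 * FreeAlgebra.ι k 1)
      (q • (FreeAlgebra.ι k 1 * FreeAlgebra.ι k 0))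

end QuantumPlane

/-- The quantum plane `k_q[x,y]`. -/
abbrev QuantumPlane {k : Type*} [Field k] (q : k) : Type _ := RingQuot (QuantumPlane.Rel q)

namespace QuantumPlane

variable {k : Type*} [Field k] (q : k) {A : Type*} [Ring A] [Algebra k A]

/-- The generators `x` (index `0`) and `y` (index `1`) of the quantum plane. -/
noncomputable def gen (i : Fin 2) : QuantumPlane q :=
  RingQuot.mkAlgHom k (Rel q) (FreeAlgebra.ι k i)

theorem gen_zero_mul_gen_one : gen q 0 * gen q 1 = q • (gen q 1 * gen q 0) := by
  simpa [gen] using RingQuot.mkAlgHom_rel k (Rel.comm (q := q))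

theorem exists_lift {a b : A} (h : a * b = q • (b * a)) :
    ∃ f : QuantumPlane q →ₐ[k] A, f (gen q 0) = a ∧ f (gen q 1) = b := by
  have w : ∀ ⦃u v⦄, Rel q u v → FreeAlgebra.lift k ![a, b] u = FreeAlgebra.lift k ![a, b] v := by
    rintro _ _ ⟨⟩
    simpa using h
  refine ⟨RingQuot.liftAlgHom k ⟨FreeAlgebra.lift k ![a, b], w⟩, ?_, ?_⟩ <;>
    simp [gen, RingQuot.liftAlgHom_mkAlgHom_apply]

end QuantumPlane

section QCommuting

variable {k : Type*} [Field k] {q : k} {A : Type*} [Ring A] [Algebra k A]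

theorem mul_pow_of_mul_eq_smul_mul {a b : A} (h : a * b = q • (b * a)) (n : ℕ) :
    a * b ^ n = q ^ n • (b ^ n * a) := by
  induction n with
  | zero => simp
  | succ n ih =>
    rw [pow_succ, ← mul_assoc, ih, smul_mul_assoc, mul_assoc, h, mul_smul_comm, smul_smul,
      ← mul_assoc, pow_succ]

theorem pow_mul_of_mul_eq_smul_mul {a b : A} (h : a * b = q • (b * a)) (n : ℕ) :
    a ^ n * b = q ^ n • (b * a ^ n) := by
  induction n with
  | zero => simp
  | succ n ih =>
    rw [pow_succ, mul_assoc, h, mul_smul_comm, ← mul_assoc, ih, smul_mul_assoc, smul_smul,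
      mul_assoc, ← pow_succ, ← pow_succ']

end QCommuting

namespace QuantumPlane

variable {k : Type*} [Field k] (q : k) {A : Type*} [Ring A] [Algebra k A]

theorem span_monomials :
    Submodule.span k (Set.range fun p : ℕ × ℕ => gen q 1 ^ p.1 * gen q 0 ^ p.2) = ⊤ := by
  set S := Submodule.span k (Set.range fun p : ℕ × ℕ => gen q 1 ^ p.1 * gen q 0 ^ p.2) with hS
  have mem : ∀ i j, gen q 1 ^ i * gen q 0 ^ j ∈ S := fun i j =>
    Submodule.subset_span ⟨(i, j), rfl⟩
  have hgen : ∀ (i : Fin 2) (m), m ∈ S → gen q i * m ∈ S := by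
    intro i m hm
    induction hm using Submodule.span_induction with
    | zero => simp
    | add a b _ _ ha hb => rw [mul_add]; exact S.add_mem ha hb
    | smul c a _ ha => rw [mul_smul_comm]; exact S.smul_mem c ha
    | mem m hm =>
      obtain ⟨⟨a, b⟩, rfl⟩ := hm
      fin_cases i
      · simp only [Fin.zero_eta]
        rw [← mul_assoc, mul_pow_of_mul_eq_smul_mul (gen_zero_mul_gen_one q), smul_mul_assoc,
          mul_assoc, ← pow_succ']
        exact S.smul_mem _ (mem _ _)
      · simp only [Fin.mk_one]
        rw [← mul_assoc, ← pow_succ']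
        exact mem _ _
  have hmul : ∀ (a : FreeAlgebra k (Fin 2)) (m), m ∈ S → RingQuot.mkAlgHom k (Rel q) a * m ∈ S := by
    intro a
    induction a with
    | grade0 c =>
      intro m hm
      rw [AlgHom.commutes, ← Algebra.smul_def]
      exact S.smul_mem c hm
    | grade1 i => exact hgen i
    | mul a b ha hb =>
      intro m hm
      rw [map_mul, mul_assoc]
      exact ha _ (hb _ hm)
    | add a b ha hb =>
      intro m hm
      rw [map_add, add_mul]
      exact S.add_mem (ha _ hm) (hb _ hm)
  refine eq_top_iff.2 fun w _ => ?_
  obtain ⟨a, rfl⟩ := RingQuot.mkAlgHom_surjective k (Rel q) w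
  simpa using hmul a 1 (by simpa using mem 0 0)

variable {q}

theorem injective_of_linearIndependent (f : QuantumPlane q →ₐ[k] A)
    (h : LinearIndependent k fun p : ℕ × ℕ => f (gen q 1) ^ p.1 * f (gen q 0) ^ p.2) :
    Function.Injective f := by
  rw [injective_iff_map_eq_zero]
  intro w hw
  obtain ⟨c, rfl⟩ := Finsupp.mem_span_range_iff_exists_finsupp.1
    ((span_monomials q).ge (Submodule.mem_top (x := w)))
  have : c = 0 := by
    refine (linearIndependent_iff.1 h) c ?_
    simpa [Finsupp.linearCombination_apply, Finsupp.sum, map_sum] using hw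
  simp [this]

end QuantumPlane

/-- Linear independence of the monomials `yⁱxʲ` as left independence of the powers of `x` over
`k[y]`. -/
theorem LinearIndependent.eq_zero_of_sum_aeval_mul_pow_eq_zero {k A : Type*} [Field k] [Ring A]
    [Algebra k A] {x y : A} (h : LinearIndependent k fun p : ℕ × ℕ => y ^ p.1 * x ^ p.2)
    {n : ℕ} {P : ℕ → k[X]} (hP : ∑ j ∈ Finset.range n, aeval y (P j) * x ^ j = 0)
    {j : ℕ} (hj : j < n) : P j = 0 := by
  set m := (Finset.range n).sup (fun j => (P j).natDegree) + 1 with hm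
  have hdeg : ∀ j ∈ Finset.range n, (P j).natDegree < m := fun j hj =>
    Nat.lt_succ_of_le (Finset.le_sup (f := fun j => (P j).natDegree) hj)
  have key := linearIndependent_iff'.1 h (Finset.range m ×ˢ Finset.range n)
    (fun p => (P p.2).coeff p.1) ?_
  · ext i
    by_cases hi : i < m
    · simpa using key (i, j) (by simp [hi, hj])
    · rw [coeff_zero]
      exact coeff_eq_zero_of_natDegree_lt
        ((hdeg j (Finset.mem_range.2 hj)).trans_le (not_lt.1 hi))
  · rw [Finset.sum_product_right, ← hP]
    refine Finset.sum_congr rfl fun j hj => ?_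
    rw [aeval_eq_sum_range' (hdeg j hj), Finset.sum_mul]
    simp only [smul_mul_assoc]

namespace IsQDivisionRing

variable {k : Type*} [Field k] {q : k} {D : Type*} [DivisionRing D] [Algebra k D] {x y : D}

theorem mul_eq_smul (hD : IsQDivisionRing k D q x y) : x * y = q • (y * x) := by
  rw [hD.rel, Algebra.smul_def]

theorem inv_mul_inv (hq : q ≠ 0) (hD : IsQDivisionRing k D q x y) :
    x⁻¹ * y⁻¹ = q • (y⁻¹ * x⁻¹) := by
  have h := congrArg (·⁻¹) hD.mul_eq_smul
  simp only [mul_inv_rev, smul_inv₀] at h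
  rw [h, smul_smul, mul_inv_cancel₀ hq, one_smul]

theorem mul_inv (hq : q ≠ 0) (hD : IsQDivisionRing k D q x y) :
    x * y⁻¹ = q⁻¹ • (y⁻¹ * x) := by
  have hy := hD.y_ne_zero
  rw [eq_inv_smul_iff₀ hq, ← mul_right_inj' hy, mul_smul_comm, ← mul_assoc,
    ← smul_mul_assoc, ← hD.mul_eq_smul, mul_inv_cancel_right₀ hy, mul_inv_cancel_left₀ hy]

theorem twist_ne_zero (hD : IsQDivisionRing k D q x y) : y⁻¹ - q⁻¹ • y ≠ 0 := by
  intro h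
  have h1 := hD.monomials_linearIndependent.eq_zero_of_sum_aeval_mul_pow_eq_zero
    (n := 1) (P := fun _ => 1 - C q⁻¹ * X ^ 2) (by
      have : y * (y⁻¹ - q⁻¹ • y) = 0 := by rw [h, mul_zero]
      rw [mul_sub, mul_inv_cancel₀ hD.y_ne_zero, mul_smul_comm, ← sq] at this
      simpa [Algebra.smul_def] using this) zero_lt_one
  simpa using congrArg (coeff · 0) h1

theorem exists_pow_mul_twist_pow_mul_pow (hq : q ≠ 0) (hD : IsQDivisionRing k D q x y) (j : ℕ) :
    ∃ G : k[X], G ≠ 0 ∧ y ^ j * ((y⁻¹ - q⁻¹ • y) * x⁻¹) ^ j * x ^ j = aeval y G := by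
  have hy := hD.y_ne_zero
  induction j with
  | zero => exact ⟨1, one_ne_zero, by simp⟩
  | succ j ih =>
    obtain ⟨G, hG, h⟩ := ih
    refine ⟨(C (q ^ j) - C (q⁻¹ * (q ^ j)⁻¹) * X ^ 2) * G, mul_ne_zero (fun h0 => ?_) hG, ?_⟩
    · exact pow_ne_zero j hq (by simpa [-map_pow] using congrArg (coeff · 0) h0)
    · have h1 : y⁻¹ * x ^ j = q ^ j • (x ^ j * y⁻¹) := by
        rw [pow_mul_of_mul_eq_smul_mul (hD.mul_inv hq), smul_smul, inv_pow,
          mul_inv_cancel₀ (pow_ne_zero j hq), one_smul]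
      have h2 : y * x ^ j = (q ^ j)⁻¹ • (x ^ j * y) := by
        rw [pow_mul_of_mul_eq_smul_mul hD.mul_eq_smul, smul_smul,
          inv_mul_cancel₀ (pow_ne_zero j hq), one_smul]
      have h3 : (y⁻¹ - q⁻¹ • y) * x⁻¹ * x ^ (j + 1) =
          x ^ j * (q ^ j • y⁻¹ - (q⁻¹ * (q ^ j)⁻¹) • y) := by
        rw [pow_succ', mul_assoc, inv_mul_cancel_left₀ hD.x_ne_zero, sub_mul, h1, smul_mul_assoc,
          h2, mul_sub, mul_smul_comm, mul_smul_comm, smul_smul]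
      have h4 : (q ^ j • y⁻¹ - (q⁻¹ * (q ^ j)⁻¹) • y) * y =
          aeval y (C (q ^ j) - C (q⁻¹ * (q ^ j)⁻¹) * X ^ 2) := by
        rw [sub_mul, smul_mul_assoc, smul_mul_assoc, inv_mul_cancel₀ hy, ← sq]
        simp only [map_sub, map_mul, aeval_C, map_pow, aeval_X, Algebra.smul_def, mul_one]
      have h5 : y * (q ^ j • y⁻¹ - (q⁻¹ * (q ^ j)⁻¹) • y) =
          (q ^ j • y⁻¹ - (q⁻¹ * (q ^ j)⁻¹) • y) * y := by
        simp only [mul_sub, sub_mul, mul_smul_comm, smul_mul_assoc, mul_inv_cancel₀ hy,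
          inv_mul_cancel₀ hy]
      calc y ^ (j + 1) * ((y⁻¹ - q⁻¹ • y) * x⁻¹) ^ (j + 1) * x ^ (j + 1)
          = y * (y ^ j * ((y⁻¹ - q⁻¹ • y) * x⁻¹) ^ j *
              ((y⁻¹ - q⁻¹ • y) * x⁻¹ * x ^ (j + 1))) := by
            rw [pow_succ' y, pow_succ ((y⁻¹ - q⁻¹ • y) * x⁻¹)]
            simp only [mul_assoc]
        _ = y * (aeval y G * (q ^ j • y⁻¹ - (q⁻¹ * (q ^ j)⁻¹) • y)) := by
            rw [h3, ← mul_assoc _ (x ^ j), h]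
        _ = aeval y (X : k[X]) * (aeval y G * (q ^ j • y⁻¹ - (q⁻¹ * (q ^ j)⁻¹) • y)) := by rw [aeval_X]
        _ = aeval y G * (y * (q ^ j • y⁻¹ - (q⁻¹ * (q ^ j)⁻¹) • y)) := by
            rw [← mul_assoc, ← map_mul, mul_comm, map_mul, aeval_X, mul_assoc]
        _ = aeval y ((C (q ^ j) - C (q⁻¹ * (q ^ j)⁻¹) * X ^ 2) * G) := by
            rw [h5, h4, ← map_mul, mul_comm]

theorem linearIndependent_twist (hq : q ≠ 0) (hD : IsQDivisionRing k D q x y) :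
    LinearIndependent k
      fun p : ℕ × ℕ => (-y⁻¹) ^ p.1 * ((y⁻¹ - q⁻¹ • y) * x⁻¹) ^ p.2 := by
  have hx := hD.x_ne_zero
  have hy := hD.y_ne_zero
  set z := (y⁻¹ - q⁻¹ • y) * x⁻¹ with hz
  choose G hG0 hG using hD.exists_pow_mul_twist_pow_mul_pow hq
  rw [linearIndependent_iff]
  intro l hl
  obtain ⟨n, hn⟩ : ∃ n, ∀ p ∈ l.support, p.1 < n ∧ p.2 < n := by
    refine ⟨l.support.sup (fun p => max p.1 p.2) + 1, fun p hp => ?_⟩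
    have := Finset.le_sup (f := fun p : ℕ × ℕ => max p.1 p.2) hp
    exact ⟨by omega, by omega⟩
  have hterm : ∀ i < n, ∀ j < n, y ^ (2 * n) * ((-y⁻¹) ^ i * z ^ j) * x ^ (n - 1) =
      aeval y (C ((-1) ^ i) * X ^ (2 * n - i - j) * G j) * x ^ (n - 1 - j) := by
    intro i hi j hj
    have e1 : y ^ (2 * n) * (-y⁻¹) ^ i = (-1) ^ i * y ^ (2 * n - i - j) * y ^ j := by
      rw [← neg_one_mul y⁻¹, (Commute.neg_one_left y⁻¹).mul_pow, ← mul_assoc,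
        ((Commute.neg_one_right (y ^ (2 * n))).pow_right i).eq, mul_assoc, mul_assoc, ← pow_add,
        inv_pow, ← pow_sub₀ y hy (by omega)]
      congr 2
      omega
    have e2 : x ^ (n - 1) = x ^ j * x ^ (n - 1 - j) := by
      rw [← pow_add]
      congr 1
      omega
    rw [← mul_assoc, e1, e2, map_mul, ← hG j]
    simp [hz, mul_assoc]
  have hsum : ∑ j ∈ Finset.range n, ∑ i ∈ Finset.range n, l (i, j) • ((-y⁻¹) ^ i * z ^ j) = 0 := by
    rw [← Finset.sum_product_right', ← hl, Finsupp.linearCombination_apply, Finsupp.sum]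
    refine (Finset.sum_subset (fun p hp => ?_) fun p _ hp => ?_).symm
    · simpa using hn p hp
    · rw [Finsupp.notMem_support_iff.1 hp, zero_smul]
  set P : ℕ → k[X] := fun j =>
    (∑ i ∈ Finset.range n, C (l (i, j) * (-1) ^ i) * X ^ (2 * n - i - j)) * G j with hP
  have hzero : ∑ j ∈ Finset.range n, aeval y (P (n - 1 - j)) * x ^ j = 0 := by
    rw [← Finset.sum_range_reflect]
    have := congrArg (fun d => y ^ (2 * n) * d * x ^ (n - 1)) hsum
    simp only [mul_zero, zero_mul, Finset.mul_sum, Finset.sum_mul] at this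
    rw [← this]
    refine Finset.sum_congr rfl fun j hj => ?_
    have hj' := Finset.mem_range.1 hj
    rw [show n - 1 - (n - 1 - j) = j by omega, hP]
    simp only [Finset.sum_mul, map_sum]
    refine Finset.sum_congr rfl fun i hi => ?_
    rw [mul_smul_comm, smul_mul_assoc, hterm i (Finset.mem_range.1 hi) j hj', C_mul,
      mul_assoc (C (l (i, j))), mul_assoc (C (l (i, j))), map_mul, aeval_C, mul_assoc,
      ← Algebra.smul_def]
  ext ⟨i, j⟩
  by_contra hne
  obtain ⟨hi, hj⟩ := hn (i, j) (Finsupp.mem_support_iff.2 hne)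
  simp only at hi hj
  have hPj : P j = 0 := by
    have := hD.monomials_linearIndependent.eq_zero_of_sum_aeval_mul_pow_eq_zero hzero
      (j := n - 1 - j) (by omega)
    rwa [show n - 1 - (n - 1 - j) = j by omega] at this
  have hcoeff := congrArg (coeff · (2 * n - i - j)) ((mul_eq_zero.1 hPj).resolve_right (hG0 j))
  simp only [finsetSum_coeff, coeff_C_mul, coeff_X_pow, coeff_zero] at hcoeff
  rw [Finset.sum_eq_single_of_mem i (Finset.mem_range.2 hi)] at hcoeff
  · exact hne (by simpa using hcoeff)
  · intro b hb hbi
    rw [Finset.mem_range] at hb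
    rw [if_neg (by omega), mul_zero]

/-- A `k`-algebra homomorphism from `D` is determined by the images of `x` and `y`. -/
theorem algHom_ext (hD : IsQDivisionRing k D q x y) {E : Type*} [DivisionRing E] [Algebra k E]
    {f g : D →ₐ[k] E} (hx : f x = g x) (hy : f y = g y) : f = g := by
  have hadj : Set.EqOn f g (Algebra.adjoin k ({x, y} : Set D)) :=
    AlgHom.eqOn_adjoin_iff.2 (by rintro _ (rfl | rfl) <;> assumption)
  ext d
  obtain ⟨s, t, hs, ht, -, rfl⟩ := hD.exists_frac d
  rw [map_mul, map_mul, map_inv₀, map_inv₀, hadj hs, hadj ht]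

theorem exists_algHom (hD : IsQDivisionRing k D q x y) {E : Type*} [DivisionRing E] [Algebra k E]
    {a b : E} (hab : a * b = q • (b * a))
    (hind : LinearIndependent k fun p : ℕ × ℕ => b ^ p.1 * a ^ p.2) :
    ∃ φ : D →ₐ[k] E, φ x = a ∧ φ y = b := by
  obtain ⟨f, hfx, hfy⟩ := QuantumPlane.exists_lift q hD.mul_eq_smul
  obtain ⟨g, hgx, hgy⟩ := QuantumPlane.exists_lift q hab
  have hrange : Algebra.adjoin k ({x, y} : Set D) ≤ f.range :=
    Algebra.adjoin_le (by rintro _ (rfl | rfl); exacts [⟨_, hfx⟩, ⟨_, hfy⟩])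
  obtain ⟨φ, hφ⟩ := exists_algHom_extending_of_left_fractions f g
    (QuantumPlane.injective_of_linearIndependent f
      (by rw [hfx, hfy]; exact hD.monomials_linearIndependent))
    (QuantumPlane.injective_of_linearIndependent g (by rw [hgx, hgy]; exact hind))
    (fun d => by
      obtain ⟨s, t, hs, ht, ht0, rfl⟩ := hD.exists_frac d
      obtain ⟨s, rfl⟩ := hrange hs
      obtain ⟨t, rfl⟩ := hrange ht
      exact ⟨s, t, by rintro rfl; exact ht0 (map_zero f), rfl⟩)
  exact ⟨φ, by rw [← hfx, hφ, hgx], by rw [← hfy, hφ, hgy]⟩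

end IsQDivisionRing

/-- The assignments `x ↦ (y⁻¹ − q⁻¹y)x⁻¹`, `y ↦ −y⁻¹` extend to a `k`-algebra automorphism
`φ` of `D = k_q(x,y)`, and `φ` has order 2, i.e. `φ ∘ φ` is the identity on `D`. -/
theorem stmt0 (k : Type*) [Field k] [CharZero k] (q : k) (hq : q ≠ 0)
    (D : Type*) [DivisionRing D] [Algebra k D] (x y : D)
    (hD : IsQDivisionRing k D q x y) :
    ∃ φ : D ≃ₐ[k] D,
      φ x = (y⁻¹ - (algebraMap k D q)⁻¹ * y) * x⁻¹ ∧
      φ y = -y⁻¹ ∧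
      ∀ d : D, φ (φ d) = d := by
  have hy := hD.y_ne_zero
  have hq1 : (algebraMap k D q)⁻¹ * y = q⁻¹ • y := by rw [Algebra.smul_def, map_inv₀]
  rw [hq1]
  have hrel : (y⁻¹ - q⁻¹ • y) * x⁻¹ * -y⁻¹ = q • (-y⁻¹ * ((y⁻¹ - q⁻¹ • y) * x⁻¹)) := by
    have hc : (y⁻¹ - q⁻¹ • y) * y⁻¹ = y⁻¹ * (y⁻¹ - q⁻¹ • y) := by
      simp only [mul_sub, sub_mul, mul_smul_comm, smul_mul_assoc, mul_inv_cancel₀ hy,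
        inv_mul_cancel₀ hy]
    rw [mul_neg, mul_assoc, hD.inv_mul_inv hq, mul_smul_comm, ← mul_assoc, hc, neg_mul, smul_neg,
      mul_assoc]
  obtain ⟨φ, hφx, hφy⟩ := hD.exists_algHom hrel (hD.linearIndependent_twist hq)
  have hmove : (q⁻¹ • y⁻¹ - y) * x = x * (y⁻¹ - q⁻¹ • y) := by
    rw [mul_sub, hD.mul_inv hq, mul_smul_comm, hD.mul_eq_smul, smul_smul, inv_mul_cancel₀ hq,
      one_smul, sub_mul, smul_mul_assoc]
  have hφφ : φ.comp φ = AlgHom.id k D := by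
    refine hD.algHom_ext ?_ ?_
    · have hφt : φ (y⁻¹ - q⁻¹ • y) = q⁻¹ • y⁻¹ - y := by
        rw [map_sub, map_smul, map_inv₀, hφy, inv_neg, inv_inv, smul_neg]
        abel
      rw [AlgHom.comp_apply, hφx, map_mul, map_inv₀, hφt, hφx, mul_inv_rev, inv_inv, ← mul_assoc,
        hmove, mul_inv_cancel_right₀ hD.twist_ne_zero, AlgHom.id_apply]
    · simp [hφy]
  exact ⟨AlgEquiv.ofAlgHom φ φ hφφ hφφ, hφx, hφy, fun d => DFunLike.congr_fun hφφ d⟩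
end

section
/- The elements h and g of D are fixed by φ (φ(h) = h and φ(g) = g) and satisfy the quantum Weyl relation hg − qgh = 1 − q; equivalently, ab⁻¹c − qcb⁻¹a = (1−q)b in D. -/
/-- If `Q` is central, `X` `Q`-commutes with `y`, `Z` `Q`-commutes with `v`, and `e` is a left
inverse of `y + v` commuting with `y` and `v`, then the defect of `Q`-commutation of `X - Z` and
`Xy + Zv` with `e` in between is `Q` times the commutator of `X` and `Z`. -/
lemma sub_mul_mul_add_sub_eq_commutator {R : Type*} [Ring R] {Q X Z y v e : R}
    (hQ : ∀ r, Q * r = r * Q) (hey : y * e = e * y) (hev : v * e = e * v)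
    (he : e * (y + v) = 1) (hXy : X * y = Q * (y * X)) (hZv : Z * v = Q * (v * Z)) :
    (X - Z) * e * (X * y + Z * v) - Q * ((X * y + Z * v) * e * (X - Z)) =
      Q * (X * Z - Z * X) := by
  have h₁ : Q * (X * y * e * X) = X * e * (X * y) := by
    rw [mul_assoc X y e, hey, hXy]
    simp only [mul_assoc, hQ]
  have h₂ : Q * (Z * v * e * Z) = Z * e * (Z * v) := by
    rw [mul_assoc Z v e, hev, hZv]
    simp only [mul_assoc, hQ]
  have h₃ : X * e * (Z * v) + Q * (X * y * e * Z) = Q * (X * Z) := by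
    calc _ = Q * (X * (e * (y + v)) * Z) := by
          rw [hZv, mul_assoc X y e, hey]
          simp only [mul_assoc, hQ, mul_add, add_mul]
          abel
      _ = _ := by rw [he, mul_one]
  have h₄ : Z * e * (X * y) + Q * (Z * v * e * X) = Q * (Z * X) := by
    calc _ = Q * (Z * (e * (y + v)) * X) := by
          rw [hXy, mul_assoc Z v e, hev]
          simp only [mul_assoc, hQ, mul_add, add_mul]
      _ = _ := by rw [he, mul_one]
  calc _ = X * e * (X * y) - Q * (X * y * e * X) - (Z * e * (Z * v) - Q * (Z * v * e * Z))
        + (X * e * (Z * v) + Q * (X * y * e * Z))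
        - (Z * e * (X * y) + Q * (Z * v * e * X)) := by
          simp only [mul_sub, sub_mul, mul_add, add_mul]
          abel
    _ = _ := by rw [h₁, h₂, h₃, h₄]; noncomm_ring

/-- In a `q`-division ring, `y² ≠ -1`. -/
lemma IsQDivisionRing.add_inv_ne_zero {k D : Type*} [Field k] [DivisionRing D] [Algebra k D]
    {q : k} {x y : D} (hD : IsQDivisionRing k D q x y) : y + y⁻¹ ≠ 0 := by
  intro h
  have hy := hD.y_ne_zero
  have h2 : y ^ 2 + 1 = 0 := by
    have := congrArg (y * ·) h
    simpa [mul_add, hy, sq] using this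
  have hli := (linearIndependent_iff'.1 hD.monomials_linearIndependent)
    {(2, 0), (0, 0)} (fun _ => 1) (by simpa using h2) (2, 0) (by simp)
  exact one_ne_zero hli

/-- The elements `h = b⁻¹a` and `g = b⁻¹c` of `D` are fixed by `φ` and satisfy the quantum
Weyl relation `hg − qgh = 1 − q`; equivalently, `ab⁻¹c − qcb⁻¹a = (1−q)b` in `D`. -/
theorem stmt1 (k : Type*) [Field k] [CharZero k] (q : k) (hq : q ≠ 0)
    (D : Type*) [DivisionRing D] [Algebra k D] (x y : D)
    (hD : IsQDivisionRing k D q x y)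
    (φ : D ≃ₐ[k] D)
    (hφx : φ x = (y⁻¹ - (algebraMap k D q)⁻¹ * y) * x⁻¹)
    (hφy : φ y = -y⁻¹) :
    let Q : D := algebraMap k D q
    let Λ : D := y⁻¹ - Q⁻¹ * y
    let a : D := x - Λ * x⁻¹
    let b : D := y + y⁻¹
    let c : D := x * y + Λ * (x⁻¹ * y⁻¹)
    let h : D := b⁻¹ * a
    let g : D := b⁻¹ * c
    φ h = h ∧ φ g = g ∧
      h * g - Q * (g * h) = 1 - Q ∧
      a * b⁻¹ * c - Q * (c * b⁻¹ * a) = (1 - Q) * b := by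
  intro Q Λ a b c h g
  have hx := hD.x_ne_zero
  have hy := hD.y_ne_zero
  have hb : b ≠ 0 := hD.add_inv_ne_zero
  have hQ0 : Q ≠ 0 := (map_ne_zero (algebraMap k D)).2 hq
  have hQ : ∀ r, Q * r = r * Q := Algebra.commutes q
  have hQi : ∀ r, Q⁻¹ * r = r * Q⁻¹ := fun r => ((show Commute Q r from hQ r).inv_left₀).eq
  have hxy : x * y = Q * (y * x) := hD.rel
  have hvx : y⁻¹ * x = Q * (x * y⁻¹) := by
    calc y⁻¹ * x = y⁻¹ * (x * y) * y⁻¹ := by simp [mul_assoc, hy]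
      _ = Q * (x * y⁻¹) := by
        rw [hxy, hQ, hQ]
        simp [mul_assoc, hy, hQ]
  have hyu : y * x⁻¹ = Q * (x⁻¹ * y) := by
    calc y * x⁻¹ = x⁻¹ * (x * y) * x⁻¹ := by simp [hx]
      _ = Q * (x⁻¹ * y) := by
        rw [hxy, hQ, hQ]
        simp [mul_assoc, hx, hQ]
  have huv : x⁻¹ * y⁻¹ = Q * (y⁻¹ * x⁻¹) := by
    calc x⁻¹ * y⁻¹ = y⁻¹ * (y * x⁻¹) * y⁻¹ := by simp [hy]
      _ = Q * (y⁻¹ * x⁻¹) := by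
        rw [hyu, hQ, hQ]
        simp [mul_assoc, hy, hQ]
  have hΛy : Λ * y = y * Λ := by
    simp only [Λ, sub_mul, mul_sub, mul_assoc, hQi]
    simp [hy]
  have hΛv : Λ * y⁻¹ = y⁻¹ * Λ := by
    simp only [Λ, sub_mul, mul_sub, mul_assoc, hQi]
    simp [hy]
  have hxΛ : x * Λ = (Q⁻¹ * y⁻¹ - y) * x := by
    have h₁ : x * y⁻¹ = Q⁻¹ * (y⁻¹ * x) := by rw [hvx, inv_mul_cancel_left₀ hQ0]
    have h₂ : x * (Q⁻¹ * y) = y * x := by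
      rw [← mul_assoc, ← hQi, mul_assoc, hxy, inv_mul_cancel_left₀ hQ0]
    simp only [Λ, mul_sub, sub_mul, h₁, h₂, mul_assoc]
  have hΛ0 : Λ ≠ 0 := by
    intro h0
    have h₁ : φ x = Λ * x⁻¹ := hφx
    rw [h0, zero_mul] at h₁
    exact hx ((map_eq_zero φ).1 h₁)
  have hφQ : φ Q = Q := φ.commutes q
  have hφx' : φ x = Λ * x⁻¹ := hφx
  have hφΛ : φ Λ = Q⁻¹ * y⁻¹ - y := by
    simp only [Λ, map_sub, map_mul, map_inv₀, hφQ, hφy, inv_neg, inv_inv]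
    noncomm_ring
  have hφZ : φ (Λ * x⁻¹) = x := by
    rw [map_mul, map_inv₀, hφx', hφΛ, mul_inv_rev, inv_inv, ← mul_assoc, ← hxΛ,
      mul_inv_cancel_right₀ hΛ0]
  have hφv : φ y⁻¹ = -y := by rw [map_inv₀, hφy, inv_neg, inv_inv]
  have hφa : φ a = -a := by
    simp only [a, map_sub, hφZ, hφx', neg_sub]
  have hφb : φ b = -b := by
    simp only [b, map_add, hφy, hφv]
    abel
  have hc : c = x * y + Λ * x⁻¹ * y⁻¹ := by simp only [c, mul_assoc]
  have hφc : φ c = -c := by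
    rw [hc, map_add, map_mul, map_mul, hφZ, hφx', hφy, hφv]
    noncomm_ring
  have hrel : a * b⁻¹ * c - Q * (c * b⁻¹ * a) = (1 - Q) * b := by
    have hyb : Commute y b := (Commute.refl y).add_right (Commute.refl y).inv_right₀
    have hvb : Commute y⁻¹ b := hyb.inv_left₀
    have hZv : Λ * x⁻¹ * y⁻¹ = Q * (y⁻¹ * (Λ * x⁻¹)) := by
      rw [mul_assoc, huv, ← mul_assoc y⁻¹, ← hΛv, ← mul_assoc, ← hQ]
      simp only [mul_assoc]
    rw [hc, sub_mul_mul_add_sub_eq_commutator hQ hyb.inv_right₀.eq hvb.inv_right₀.eq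
      (inv_mul_cancel₀ hb) hxy hZv, ← mul_assoc x, hxΛ, mul_inv_cancel_right₀ hx,
      inv_mul_cancel_right₀ hx]
    simp only [Λ, b, mul_sub, mul_inv_cancel_left₀ hQ0, sub_mul, mul_add, one_mul]
    abel
  refine ⟨?_, ?_, ?_, hrel⟩
  · simp only [h, map_mul, map_inv₀, hφa, hφb, inv_neg, neg_mul_neg]
  · simp only [g, map_mul, map_inv₀, hφc, hφb, inv_neg, neg_mul_neg]
  · calc h * g - Q * (g * h) = b⁻¹ * (a * b⁻¹ * c - Q * (c * b⁻¹ * a)) := by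
          rw [mul_sub, ← mul_assoc b⁻¹ Q, ← hQ b⁻¹]
          simp only [h, g, mul_assoc]
      _ = 1 - Q := by
          rw [hrel, sub_mul, hQ b, one_mul, mul_sub, inv_mul_cancel₀ hb,
            inv_mul_cancel_left₀ hb]
end

section
/- In D the following identities hold: y − y⁻¹ = (hg − 1)⁻¹(qg² − h²); x = y⁻¹h + q⁻¹g; x + Λx⁻¹ = (y⁻¹ − y)h + 2q⁻¹g; and xy − Λx⁻¹y⁻¹ = 2qh + (y − y⁻¹)g. In particular, the elements x + Λx⁻¹, y − y⁻¹ and xy − Λx⁻¹y⁻¹ all lie in R, the division subring of D generated over k by h and g. -/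
/-- `MemDivisionClosure k s d` says that `d` lies in the division subring of `D`
generated over `k` by the set `s`. -/
inductive MemDivisionClosure (k : Type*) [Field k] {D : Type*} [DivisionRing D] [Algebra k D]
    (s : Set D) : D → Prop
  | mem {a : D} : a ∈ s → MemDivisionClosure k s a
  | scalar (c : k) : MemDivisionClosure k s (algebraMap k D c)
  | add {a b : D} : MemDivisionClosure k s a → MemDivisionClosure k s b →
      MemDivisionClosure k s (a + b)
  | neg {a : D} : MemDivisionClosure k s a → MemDivisionClosure k s (-a)
  | mul {a b : D} : MemDivisionClosure k s a → MemDivisionClosure k s b →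
      MemDivisionClosure k s (a * b)
  | inv {a : D} : MemDivisionClosure k s a → MemDivisionClosure k s a⁻¹

section QuantumRelations

variable {k : Type*} [Field k] {D : Type*} [DivisionRing D] [Algebra k D] {q : k} {x y u h g : D}

/-- The commutation relations satisfied by `x`, `y` and `u = Λx⁻¹`, together with the defining
equations of `h` and `g`. -/
structure QuantumRelations (q : k) (x y u h g : D) : Prop where
  q_ne_zero : q ≠ 0
  y_ne_zero : y ≠ 0
  b_ne_zero : y + y⁻¹ ≠ 0
  x_mul_y : x * y = q • (y * x)
  u_mul_y : u * y = q⁻¹ • (y * u)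
  u_mul_x : u * x = y⁻¹ - q⁻¹ • y
  x_mul_u : x * u = q⁻¹ • y⁻¹ - y
  b_mul_h : (y + y⁻¹) * h = x - u
  b_mul_g : (y + y⁻¹) * g = q • (y * x + y⁻¹ * u)

theorem mul_inv_of_mul_eq_smul {c : k} (hc : c ≠ 0) (hy : y ≠ 0) (hxy : x * y = c • (y * x)) :
    x * y⁻¹ = c⁻¹ • (y⁻¹ * x) := by
  have e : y * (x * y⁻¹) = c⁻¹ • x := by
    have : y * x = c⁻¹ • (x * y) := by rw [hxy, smul_smul, inv_mul_cancel₀ hc, one_smul]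
    rw [← mul_assoc, this, smul_mul_assoc, mul_assoc, mul_inv_cancel₀ hy, mul_one]
  rw [← inv_mul_cancel_left₀ hy (x * y⁻¹), e, mul_smul_comm]

namespace QuantumRelations

variable (H : QuantumRelations q x y u h g)
include H

theorem x_mul_y_inv : x * y⁻¹ = q⁻¹ • (y⁻¹ * x) :=
  mul_inv_of_mul_eq_smul H.q_ne_zero H.y_ne_zero H.x_mul_y

theorem u_mul_y_inv : u * y⁻¹ = q • (y⁻¹ * u) := by
  simpa using mul_inv_of_mul_eq_smul (inv_ne_zero H.q_ne_zero) H.y_ne_zero H.u_mul_y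

theorem b_mul_y_inv_mul (t : D) : (y + y⁻¹) * (y⁻¹ * t) = y⁻¹ * ((y + y⁻¹) * t) := by
  simp only [← mul_assoc, add_mul, mul_add, mul_inv_cancel₀ H.y_ne_zero,
    inv_mul_cancel₀ H.y_ne_zero]

theorem b_mul_y_mul (t : D) : (y + y⁻¹) * (y * t) = y * ((y + y⁻¹) * t) := by
  simp only [← mul_assoc, add_mul, mul_add, mul_inv_cancel₀ H.y_ne_zero,
    inv_mul_cancel₀ H.y_ne_zero]

theorem x_eq : x = y⁻¹ * h + q⁻¹ • g := by
  have hq := H.q_ne_zero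
  have hy := H.y_ne_zero
  apply mul_left_cancel₀ H.b_ne_zero
  rw [mul_add, H.b_mul_y_inv_mul, mul_smul_comm, H.b_mul_h, H.b_mul_g, smul_smul,
    inv_mul_cancel₀ hq]
  simp only [mul_sub, add_mul]
  module

theorem u_eq : u = q⁻¹ • g - y * h := by
  have e : u = x - (y + y⁻¹) * h := by rw [H.b_mul_h]; abel
  rw [e, add_mul]
  nth_rewrite 1 [H.x_eq]
  abel

theorem h_mul_w : h * (y - y⁻¹) = (1 - q⁻¹ ^ 2) • g + q⁻¹ • ((y - y⁻¹) * h) := by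
  have hq := H.q_ne_zero
  have hy := H.y_ne_zero
  apply mul_left_cancel₀ H.b_ne_zero
  rw [← mul_assoc, mul_add, mul_smul_comm, mul_smul_comm, sub_mul, mul_sub (y + y⁻¹),
    H.b_mul_y_mul, H.b_mul_y_inv_mul, H.b_mul_h, H.b_mul_g]
  simp only [mul_sub, sub_mul, H.x_mul_y, H.u_mul_y, H.x_mul_y_inv, H.u_mul_y_inv]
  match_scalars <;> field_simp <;> ring

theorem g_mul_w : g * (y - y⁻¹) = (q ^ 2 - 1) • h + q • ((y - y⁻¹) * g) := by
  have hq := H.q_ne_zero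
  have hy := H.y_ne_zero
  apply mul_left_cancel₀ H.b_ne_zero
  rw [← mul_assoc, mul_add, mul_smul_comm, mul_smul_comm, sub_mul, mul_sub (y + y⁻¹),
    H.b_mul_y_mul, H.b_mul_y_inv_mul, H.b_mul_h, H.b_mul_g]
  simp only [mul_sub, mul_add, add_mul, smul_mul_assoc, mul_smul_comm, mul_assoc, H.x_mul_y,
    H.u_mul_y, H.x_mul_y_inv, H.u_mul_y_inv, mul_inv_cancel_left₀ hy, inv_mul_cancel_left₀ hy]
  match_scalars <;> field_simp <;> ring

theorem w_mul_hg_sub_one :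
    (y - y⁻¹) * (h * g - 1) = q⁻¹ • (g * g) - q ^ 2 • (h * h) := by
  have hq := H.q_ne_zero
  have hy := H.y_ne_zero
  have e₁ : y⁻¹ * (g * h) - q • (h * h) + q⁻¹ ^ 2 • (g * g) - q⁻¹ • (y * (h * g))
      = y⁻¹ - q⁻¹ • y := by
    rw [← H.u_mul_x]
    have : u * x = q • (y⁻¹ * (u * h)) + q⁻¹ • (u * g) := by
      nth_rewrite 1 [H.x_eq]
      rw [mul_add, ← mul_assoc, H.u_mul_y_inv, smul_mul_assoc, mul_assoc, mul_smul_comm]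
    rw [this, H.u_eq]
    simp only [sub_mul, mul_sub, smul_mul_assoc, mul_smul_comm, mul_assoc,
      inv_mul_cancel_left₀ hy]
    match_scalars <;> field_simp
  have e₂ : q⁻¹ • (y⁻¹ * (h * g)) + q⁻¹ ^ 2 • (g * g) - q • (h * h) - y * (g * h)
      = q⁻¹ • y⁻¹ - y := by
    rw [← H.x_mul_u]
    have : x * u = q⁻¹ • (x * g) - q • (y * (x * h)) := by
      nth_rewrite 1 [H.u_eq]
      rw [mul_sub, ← mul_assoc, H.x_mul_y, smul_mul_assoc, mul_assoc, mul_smul_comm]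
    rw [this, H.x_eq]
    simp only [add_mul, mul_add, smul_mul_assoc, mul_smul_comm, mul_assoc,
      mul_inv_cancel_left₀ hy]
    match_scalars <;> field_simp
  have e₃ : h * g - 1 = q • (g * h - 1) := by
    apply mul_left_cancel₀ H.b_ne_zero
    rw [← sub_eq_zero] at e₁ e₂ ⊢
    have := congrArg₂ (fun s t => q • (s - t)) e₂ e₁
    simp only [sub_self, smul_zero] at this
    rw [← this]
    simp only [add_mul, mul_sub, mul_smul_comm, mul_one]
    match_scalars <;> field_simp <;> ring
  have e₄ : g * h = q⁻¹ • (h * g - 1) + 1 := by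
    rw [e₃, smul_smul, inv_mul_cancel₀ hq, one_smul, sub_add_cancel]
  rw [e₄] at e₂
  rw [← sub_eq_zero] at e₂ ⊢
  have := congrArg (fun s => -q • s) e₂
  simp only [smul_zero] at this
  rw [← this]
  simp only [sub_mul, mul_add, mul_sub, mul_smul_comm, mul_one]
  match_scalars <;> field_simp <;> ring

theorem hg_sub_one_mul_w : (h * g - 1) * (y - y⁻¹) = q • (g * g) - h * h := by
  have hq := H.q_ne_zero
  have e : (h * g - 1) * (y - y⁻¹)
      = (q ^ 2 - 1) • (h * h) + (q - q⁻¹) • (g * g) + (y - y⁻¹) * (h * g - 1) := by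
    rw [sub_mul, mul_assoc, H.g_mul_w, mul_add, mul_smul_comm, mul_smul_comm,
      ← mul_assoc h, H.h_mul_w, add_mul, smul_mul_assoc, smul_mul_assoc, mul_assoc,
      mul_sub _ (h * g)]
    simp only [one_mul, mul_one]
    match_scalars <;> field_simp
  rw [e, H.w_mul_hg_sub_one]
  match_scalars <;> field_simp <;> ring

/-- The relation `hg = 1`, with denominators cleared, is a polynomial relation between `x` and
`y`. -/
theorem monomial_relation_of_hg_eq_one (hhg : h * g = 1) :
    q • (y ^ 6 * x ^ 4) + q ^ 3 • (y ^ 4 * x ^ 4)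
      - (1 + q + q⁻¹ + q ^ 2) • (y ^ 5 * x ^ 2) - (1 + q + q⁻¹ + q ^ 2) • (y ^ 3 * x ^ 2)
      - y ^ 6 - (q⁻¹ ^ 2 - q ^ 3 - q) • y ^ 4 - (q ^ 4 - q - q⁻¹) • y ^ 2 - q ^ 2 • (1 : D)
      = 0 := by
  have hq := H.q_ne_zero
  have hy := H.y_ne_zero
  have e : x * g - u * g = y + y⁻¹ := by
    rw [← sub_mul, ← H.b_mul_h, mul_assoc, hhg, mul_one]
  have comm_x : ∀ t, (q • y + q⁻¹ • y⁻¹) * (x * t) = x * ((y + y⁻¹) * t) := fun t => by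
    rw [← mul_assoc, ← mul_assoc, mul_add x, H.x_mul_y, H.x_mul_y_inv, add_mul,
      smul_mul_assoc, smul_mul_assoc, add_mul, smul_mul_assoc, smul_mul_assoc]
  have comm_u : ∀ t, (q⁻¹ • y + q • y⁻¹) * (u * t) = u * ((y + y⁻¹) * t) := fun t => by
    rw [← mul_assoc, ← mul_assoc, mul_add u, H.u_mul_y, H.u_mul_y_inv, add_mul,
      smul_mul_assoc, smul_mul_assoc, add_mul, smul_mul_assoc, smul_mul_assoc]
  have comm_b : ∀ t, (q • y + q⁻¹ • y⁻¹) * ((q⁻¹ • y + q • y⁻¹) * t)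
      = (q⁻¹ • y + q • y⁻¹) * ((q • y + q⁻¹ • y⁻¹) * t) := fun t => by
    simp only [add_mul, mul_add, smul_mul_assoc, mul_smul_comm, mul_inv_cancel_left₀ hy,
      inv_mul_cancel_left₀ hy]
    match_scalars <;> field_simp <;> ring
  have e' : (q⁻¹ • y + q • y⁻¹) * (x * (q • (y * x + y⁻¹ * u)))
      - (q • y + q⁻¹ • y⁻¹) * (u * (q • (y * x + y⁻¹ * u)))
      = (q • y + q⁻¹ • y⁻¹) * ((q⁻¹ • y + q • y⁻¹) * (y + y⁻¹)) := by
    rw [← e, mul_sub, mul_sub, comm_u, comm_b, comm_x, H.b_mul_g]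
  have xy : ∀ t, x * (y * t) = q • (y * (x * t)) := fun t => by
    rw [← mul_assoc, H.x_mul_y, smul_mul_assoc, mul_assoc]
  have xy' : ∀ t, x * (y⁻¹ * t) = q⁻¹ • (y⁻¹ * (x * t)) := fun t => by
    rw [← mul_assoc, H.x_mul_y_inv, smul_mul_assoc, mul_assoc]
  have uy : ∀ t, u * (y * t) = q⁻¹ • (y * (u * t)) := fun t => by
    rw [← mul_assoc, H.u_mul_y, smul_mul_assoc, mul_assoc]
  have uy' : ∀ t, u * (y⁻¹ * t) = q • (y⁻¹ * (u * t)) := fun t => by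
    rw [← mul_assoc, H.u_mul_y_inv, smul_mul_assoc, mul_assoc]
  have ux : ∀ t, u * (x * t) = y⁻¹ * t - q⁻¹ • (y * t) := fun t => by
    rw [← mul_assoc, H.u_mul_x, sub_mul, smul_mul_assoc]
  have e'' := congrArg (fun s => y ^ 4 * (s * x ^ 2)) e'
  rw [← sub_eq_zero] at e''
  rw [← e'']
  simp only [pow_succ, pow_zero, one_mul, mul_one, mul_assoc, add_mul, mul_add, sub_mul, mul_sub,
    smul_mul_assoc, mul_smul_comm, smul_add, smul_sub, xy, xy', uy, uy', ux, H.u_mul_x,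
    mul_inv_cancel_left₀ hy, inv_mul_cancel_left₀ hy, mul_inv_cancel₀ hy,
    inv_mul_cancel₀ hy]
  match_scalars <;> field_simp <;> ring

theorem y_sub_y_inv_eq (hhg : h * g ≠ 1) :
    y - y⁻¹ = (h * g - 1)⁻¹ * (q • g ^ 2 - h ^ 2) := by
  rw [pow_two, pow_two, ← H.hg_sub_one_mul_w, inv_mul_cancel_left₀ (sub_ne_zero.2 hhg)]

theorem x_add_u_eq : x + u = (y⁻¹ - y) * h + 2 * (q⁻¹ • g) := by
  nth_rewrite 1 [H.x_eq]
  rw [H.u_eq, sub_mul, two_mul]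
  abel

theorem x_mul_y_sub_u_mul_y_inv_eq :
    x * y - u * y⁻¹ = 2 * (q • h) + (y - y⁻¹) * g := by
  have hq := H.q_ne_zero
  have hy := H.y_ne_zero
  rw [H.x_mul_y, H.u_mul_y_inv, H.u_eq]
  nth_rewrite 1 [H.x_eq]
  simp only [mul_add, mul_sub, sub_mul, two_mul, mul_smul_comm, mul_inv_cancel_left₀ hy,
    inv_mul_cancel_left₀ hy]
  match_scalars <;> field_simp <;> ring

end QuantumRelations

end QuantumRelations

namespace IsQDivisionRing

variable {k : Type*} [Field k] {D : Type*} [DivisionRing D] [Algebra k D] {q : k} {x y : D}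

theorem y_add_y_inv_ne_zero (hD : IsQDivisionRing k D q x y) : y + y⁻¹ ≠ 0 := by
  intro hb
  have hy := hD.y_ne_zero
  have key := linearIndependent_iff.1 hD.monomials_linearIndependent
    (Finsupp.single (2, 0) 1 + Finsupp.single (0, 0) 1) (by
      have := congrArg (fun s => y * s) hb
      simpa [mul_add, mul_inv_cancel₀ hy, pow_two] using this)
  simpa using DFunLike.congr_fun key (2, 0)

theorem quantumRelations (hD : IsQDivisionRing k D q x y) (hq : q ≠ 0) :
    QuantumRelations q x y ((y⁻¹ - q⁻¹ • y) * x⁻¹)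
      ((y + y⁻¹)⁻¹ * (x - (y⁻¹ - q⁻¹ • y) * x⁻¹))
      ((y + y⁻¹)⁻¹ * (x * y + (y⁻¹ - q⁻¹ • y) * x⁻¹ * y⁻¹)) := by
  have hx := hD.x_ne_zero
  have hy := hD.y_ne_zero
  have hb := hD.y_add_y_inv_ne_zero
  have xy : x * y = q • (y * x) := by rw [Algebra.smul_def, hD.rel]
  have xy' := mul_inv_of_mul_eq_smul hq hy xy
  have yx' : x⁻¹ * y = q⁻¹ • (y * x⁻¹) := by
    have yx : y * x = q⁻¹ • (x * y) := by rw [xy, smul_smul, inv_mul_cancel₀ hq, one_smul]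
    have := mul_inv_of_mul_eq_smul (inv_ne_zero hq) hx yx
    rw [this, smul_smul, mul_inv_cancel₀ (inv_ne_zero hq), one_smul]
  have uy : (y⁻¹ - q⁻¹ • y) * x⁻¹ * y = q⁻¹ • (y * ((y⁻¹ - q⁻¹ • y) * x⁻¹)) := by
    rw [mul_assoc, yx', mul_smul_comm, ← mul_assoc, ← mul_assoc, sub_mul, mul_sub,
      inv_mul_cancel₀ hy, mul_inv_cancel₀ hy, smul_mul_assoc, mul_smul_comm]
  refine ⟨hq, hy, hb, xy, uy, inv_mul_cancel_right₀ hx _, ?_, mul_inv_cancel_left₀ hb _, ?_⟩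
  · rw [← mul_assoc, mul_sub, mul_smul_comm, xy, xy', smul_smul, inv_mul_cancel₀ hq, one_smul,
      ← smul_mul_assoc, ← sub_mul, mul_inv_cancel_right₀ hx]
  · rw [mul_inv_cancel_left₀ hb, mul_inv_of_mul_eq_smul (inv_ne_zero hq) hy uy, xy, inv_inv,
      smul_add]

theorem hg_ne_one (hD : IsQDivisionRing k D q x y) {u h g : D}
    (H : QuantumRelations q x y u h g) : h * g ≠ 1 := by
  intro hhg
  have key := linearIndependent_iff.1 hD.monomials_linearIndependent
    (Finsupp.single (6, 4) q + Finsupp.single (4, 4) (q ^ 3)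
      - Finsupp.single (5, 2) (1 + q + q⁻¹ + q ^ 2) - Finsupp.single (3, 2) (1 + q + q⁻¹ + q ^ 2)
      - Finsupp.single (6, 0) 1 - Finsupp.single (4, 0) (q⁻¹ ^ 2 - q ^ 3 - q)
      - Finsupp.single (2, 0) (q ^ 4 - q - q⁻¹) - Finsupp.single (0, 0) (q ^ 2)) (by
      simpa only [map_add, map_sub, Finsupp.linearCombination_single, pow_zero, mul_one, one_smul]
        using H.monomial_relation_of_hg_eq_one hhg)
  exact H.q_ne_zero (by simpa using DFunLike.congr_fun key (6, 4))

end IsQDivisionRing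

namespace MemDivisionClosure

variable {k : Type*} [Field k] {D : Type*} [DivisionRing D] [Algebra k D] {s : Set D} {a b : D}

theorem sub (ha : MemDivisionClosure k s a) (hb : MemDivisionClosure k s b) :
    MemDivisionClosure k s (a - b) :=
  sub_eq_add_neg a b ▸ ha.add hb.neg

theorem one : MemDivisionClosure k s (1 : D) :=
  map_one (algebraMap k D) ▸ .scalar 1

theorem smul (c : k) (ha : MemDivisionClosure k s a) : MemDivisionClosure k s (c • a) :=
  Algebra.smul_def c a ▸ (MemDivisionClosure.scalar c).mul ha

theorem two_mul (ha : MemDivisionClosure k s a) : MemDivisionClosure k s (2 * a) :=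
  _root_.two_mul a ▸ ha.add ha

end MemDivisionClosure

/-- In `D`: `y − y⁻¹ = (hg − 1)⁻¹(qg² − h²)`, `x = y⁻¹h + q⁻¹g`,
`x + Λx⁻¹ = (y⁻¹ − y)h + 2q⁻¹g`, and `xy − Λx⁻¹y⁻¹ = 2qh + (y − y⁻¹)g`.
In particular `x + Λx⁻¹`, `y − y⁻¹` and `xy − Λx⁻¹y⁻¹` all lie in `R`, the division subring
of `D` generated over `k` by `h` and `g`. -/
theorem stmt2 (k : Type*) [Field k] [CharZero k] (q : k) (hq : q ≠ 0)
    (D : Type*) [DivisionRing D] [Algebra k D] (x y : D)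
    (hD : IsQDivisionRing k D q x y) :
    let Q : D := algebraMap k D q
    let Λ : D := y⁻¹ - Q⁻¹ * y
    let a : D := x - Λ * x⁻¹
    let b : D := y + y⁻¹
    let c : D := x * y + Λ * (x⁻¹ * y⁻¹)
    let h : D := b⁻¹ * a
    let g : D := b⁻¹ * c
    y - y⁻¹ = (h * g - 1)⁻¹ * (Q * g ^ 2 - h ^ 2) ∧
    x = y⁻¹ * h + Q⁻¹ * g ∧
    x + Λ * x⁻¹ = (y⁻¹ - y) * h + 2 * (Q⁻¹ * g) ∧
    x * y - Λ * (x⁻¹ * y⁻¹) = 2 * (Q * h) + (y - y⁻¹) * g ∧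
    MemDivisionClosure k ({h, g} : Set D) (x + Λ * x⁻¹) ∧
    MemDivisionClosure k ({h, g} : Set D) (y - y⁻¹) ∧
    MemDivisionClosure k ({h, g} : Set D) (x * y - Λ * (x⁻¹ * y⁻¹)) := by
  simp only [← map_inv₀, ← Algebra.smul_def, ← mul_assoc ((_ : D) - _) x⁻¹]
  have H := hD.quantumRelations hq
  have hhg := hD.hg_ne_one H
  generalize (y⁻¹ - q⁻¹ • y) * x⁻¹ = u at H hhg ⊢
  generalize (y + y⁻¹)⁻¹ * (x - u) = h at H hhg ⊢
  generalize (y + y⁻¹)⁻¹ * (x * y + u * y⁻¹) = g at H hhg ⊢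
  have mh : MemDivisionClosure k ({h, g} : Set D) h := .mem (by simp)
  have mg : MemDivisionClosure k ({h, g} : Set D) g := .mem (by simp)
  have mw : MemDivisionClosure k ({h, g} : Set D) (y - y⁻¹) := by
    rw [H.y_sub_y_inv_eq hhg, pow_two, pow_two]
    exact ((mh.mul mg).sub .one).inv.mul (((mg.mul mg).smul q).sub (mh.mul mh))
  refine ⟨H.y_sub_y_inv_eq hhg, H.x_eq, H.x_add_u_eq, H.x_mul_y_sub_u_mul_y_inv_eq, ?_, mw, ?_⟩
  · rw [H.x_add_u_eq, ← neg_sub y]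
    exact (mw.neg.mul mh).add (mg.smul q⁻¹).two_mul
  · rw [H.x_mul_y_sub_u_mul_y_inv_eq]
    exact (mh.smul q).two_mul.add (mw.mul mg)
end
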